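/- Lemma 3.4 (Existence of a stationary distribution). Assume a₁ > 0, b₂ > 0, and ∫_{{z₁≥1}} log z₁ n(dz) < ∞. Then there exists a probability measure π on G such that for every x ∈ G the measures P_t(x,·) converge weakly to π as t → ∞; the characteristic function of π is given by ∫_G e^{⟨u,y⟩} π(dy) = exp{ ∫₀^∞ ψ(V(s,u)) ds } for all u ∈ iℝ²; and π is the unique stationary (invariant) distribution for (P_t)_{t≥0}. -/

import Mathlib

open MeasureTheory Filter Set Topology
open scoped ENNReal Classical

noncomputable section

namespace AffinePaper

/-- Total variation distance between two measures:
`‖μ - ν‖_var = sup {|∫ f dμ - ∫ f dν| : f measurable, |f| ≤ 1}`. -/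
def tvDist {α : Type*} [MeasurableSpace α] (μ ν : Measure α) : ℝ :=
  ⨆ f : {f : α → ℝ // Measurable f ∧ ∀ x, |f x| ≤ 1},
    |(∫ x, f.1 x ∂μ) - ∫ x, f.1 x ∂ν|

/-- Translate of a measure on `ℝ` by `a`, i.e. `δ_a * σ`. -/
def translate (a : ℝ) (σ : Measure ℝ) : Measure ℝ := Measure.map (fun x => x + a) σ

/-- The function `φ` of the affine process. -/
def phi (a₁ b₁ α₁₁ α₁₂ α₂₁ α₂₂ : ℝ) (m : Measure (ℝ × ℝ)) (u : ℂ × ℂ) : ℂ :=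
  -(a₁ : ℂ) * u.1 - (b₁ : ℂ) * u.2 + ((α₁₁ : ℂ) + (α₁₂ : ℂ)) * u.1 ^ 2
    + 2 * ((Real.sqrt (α₁₁ * α₂₁) : ℂ) + (Real.sqrt (α₁₂ * α₂₂) : ℂ)) * u.1 * u.2
    + ((α₂₁ : ℂ) + (α₂₂ : ℂ)) * u.2 ^ 2
    + ∫ z : ℝ × ℝ,
        (Complex.exp (u.1 * (z.1 : ℂ) + u.2 * (z.2 : ℂ)) - 1
          - (u.1 * (z.1 : ℂ) + u.2 * (z.2 : ℂ))) ∂m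

/-- The function `ψ` of the affine process. -/
def psi (a₂ b₀ σ : ℝ) (n : Measure (ℝ × ℝ)) (u : ℂ × ℂ) : ℂ :=
  (a₂ : ℂ) * u.1 - (b₀ : ℂ) * u.2 + (σ : ℂ) ^ 2 / 2 * u.2 ^ 2
    + ∫ z : ℝ × ℝ,
        (Complex.exp (u.1 * (z.1 : ℂ) + u.2 * (z.2 : ℂ)) - 1 - (z.2 : ℂ) * u.2) ∂n

/-- The branching mechanism `φ₀`. -/
def phi0 (a₁ α₁₁ α₁₂ : ℝ) (m : Measure (ℝ × ℝ)) (x : ℝ) : ℝ :=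
  a₁ * x + (α₁₁ + α₁₂) * x ^ 2 + ∫ z : ℝ × ℝ, (Real.exp (-x * z.1) - 1 + x * z.1) ∂m

/-- Condition (A): Grey's condition. -/
def CondA (a₁ α₁₁ α₁₂ : ℝ) (m : Measure (ℝ × ℝ)) : Prop :=
  ∃ θ > (0 : ℝ), (∀ z ≥ θ, 0 < phi0 a₁ α₁₁ α₁₂ m z) ∧
    ∫⁻ z in Set.Ici θ, ENNReal.ofReal (phi0 a₁ α₁₁ α₁₂ m z)⁻¹ < ⊤

/-- The measure `n_ε` on `ℝ`. -/
def nEps (n : Measure (ℝ × ℝ)) (ε : ℝ) : Measure ℝ :=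
  if n {z : ℝ × ℝ | 0 ≤ z.1} < ⊤ then
    Measure.map Prod.snd (n.restrict {z : ℝ × ℝ | 0 ≤ z.1})
  else
    Measure.map Prod.snd (n.restrict {z : ℝ × ℝ | 0 ≤ z.1 ∧ ε ≤ |z.2|})

/-- Condition (B), with the constants `ε, η` explicit. -/
def CondB (n : Measure (ℝ × ℝ)) (ε η : ℝ) : Prop :=
  0 < ε ∧ 0 < η ∧
  (∃ c : ℝ≥0∞, 0 < c ∧
      ∀ a : ℝ, |a| ≤ η → c ≤ (nEps n ε ⊓ translate a (nEps n ε)) Set.univ) ∧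
  ∫⁻ z in {z : ℝ × ℝ | ε < |z.2|}, ENNReal.ofReal |z.2| ∂n < ⊤

/-- `limsup_{ρ → 0} [ sup_{|a| ≤ ρ} ‖σ - δ_a * σ‖_var / ρ ] < ∞`. -/
def SmoothShift (σ : Measure ℝ) : Prop :=
  ∃ C > (0 : ℝ), ∃ δ > (0 : ℝ), ∀ ρ : ℝ, 0 < ρ → ρ ≤ δ →
    ∀ a : ℝ, |a| ≤ ρ → tvDist σ (translate a σ) ≤ C * ρ

/-- Condition (C), with the constant `ε` explicit. -/
def CondC (n : Measure (ℝ × ℝ)) (ε : ℝ) : Prop :=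
  0 < ε ∧ 0 < nEps n ε Set.univ ∧ SmoothShift (nEps n ε) ∧
  ∫⁻ z in {z : ℝ × ℝ | ε < |z.2|}, ENNReal.ofReal |z.2| ∂n < ⊤

/-- Condition (C'), with the constant `ε` explicit. -/
def CondC' (n : Measure (ℝ × ℝ)) (ε : ℝ) : Prop :=
  0 < ε ∧ 0 < nEps n ε Set.univ ∧ SmoothShift (nEps n ε) ∧
  ∫⁻ z in {z : ℝ × ℝ | 1 < |z.2|}, ENNReal.ofReal (z.2 ^ 2) ∂n < ⊤

/-- The measure `σ₀ = ϱ₀(z₂) dz₂` of Condition (D). -/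
def sigma0 (ϱ₀ : ℝ → ℝ) : Measure ℝ :=
  volume.withDensity fun x => ENNReal.ofReal (ϱ₀ x)

/-- The measure `σ_k = ((k g) ∧ ϱ₀)(z₂) dz₂` of Condition (D). -/
def sigmaK (ϱ₀ g : ℝ → ℝ) (k : ℕ) : Measure ℝ :=
  volume.withDensity fun x => ENNReal.ofReal (min ((k : ℝ) * g x) (ϱ₀ x))

/-- Condition (D), with `ϱ₀`, `g` and `K` explicit. -/
def CondD (n : Measure (ℝ × ℝ)) (ϱ₀ g : ℝ → ℝ) (K : ℕ) : Prop :=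
  Measurable ϱ₀ ∧ (∀ x, 0 ≤ ϱ₀ x) ∧
  (∀ B : Set ℝ, MeasurableSet B → sigma0 ϱ₀ B ≤ n {z : ℝ × ℝ | 0 ≤ z.1 ∧ z.2 ∈ B}) ∧
  0 < sigma0 ϱ₀ Set.univ ∧
  (∀ x, 0 < g x) ∧ Integrable g ∧ 1 ≤ K ∧
  ∀ k, K ≤ k → SmoothShift (sigmaK ϱ₀ g k) ∧
    ∫⁻ x, ENNReal.ofReal |x| ∂(sigmaK ϱ₀ g k) < ⊤

/-- The transition semigroup of a (1+1)-dimensional affine Markov process, together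
with all the standing assumptions of the paper. -/
structure AffineSemigroup where
  a₁ : ℝ
  a₂ : ℝ
  b₀ : ℝ
  b₁ : ℝ
  b₂ : ℝ
  σ : ℝ
  α₁₁ : ℝ
  α₁₂ : ℝ
  α₂₁ : ℝ
  α₂₂ : ℝ
  m : Measure (ℝ × ℝ)
  n : Measure (ℝ × ℝ)
  V₁ : ℝ → ℂ × ℂ → ℂ
  P : ℝ → ℝ × ℝ → Measure (ℝ × ℝ)
  a₂_nonneg : 0 ≤ a₂
  σ_nonneg : 0 ≤ σ
  α₁₁_nonneg : 0 ≤ α₁₁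
  α₁₂_nonneg : 0 ≤ α₁₂
  α₂₁_nonneg : 0 ≤ α₂₁
  α₂₂_nonneg : 0 ≤ α₂₂
  m_supp : m {z : ℝ × ℝ | z.1 < 0 ∨ z = 0} = 0
  n_supp : n {z : ℝ × ℝ | z.1 < 0 ∨ z = 0} = 0
  m_int : ∫⁻ z : ℝ × ℝ, ENNReal.ofReal (min z.1 (z.1 ^ 2) + z.2 ^ 2) ∂m < ⊤
  n_int : ∫⁻ z : ℝ × ℝ, ENNReal.ofReal (min 1 z.1 + min |z.2| (z.2 ^ 2)) ∂n < ⊤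
  V₁_init : ∀ u : ℂ × ℂ, V₁ 0 u = u.1
  V₁_mem : ∀ u : ℂ × ℂ, u.1.re ≤ 0 → u.2.re = 0 → ∀ t, 0 ≤ t → (V₁ t u).re ≤ 0
  V₁_ode : ∀ u : ℂ × ℂ, u.1.re ≤ 0 → u.2.re = 0 → ∀ t, 0 ≤ t →
    HasDerivAt (fun s => V₁ s u)
      (phi a₁ b₁ α₁₁ α₁₂ α₂₁ α₂₂ m
        (V₁ t u, Complex.exp (-(b₂ : ℂ) * (t : ℂ)) * u.2)) t
  P_prob : ∀ t, 0 ≤ t → ∀ x : ℝ × ℝ, 0 ≤ x.1 → IsProbabilityMeasure (P t x)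
  P_supp : ∀ t, 0 ≤ t → ∀ x : ℝ × ℝ, 0 ≤ x.1 → P t x {ξ : ℝ × ℝ | ξ.1 < 0} = 0
  P_meas : ∀ t, 0 ≤ t → Measurable (P t)
  P_zero : ∀ x : ℝ × ℝ, P 0 x = Measure.dirac x
  P_CK : ∀ t, 0 ≤ t → ∀ s, 0 ≤ s → ∀ x : ℝ × ℝ, P (t + s) x = (P t x).bind (P s)
  P_char : ∀ t, 0 ≤ t → ∀ x : ℝ × ℝ, 0 ≤ x.1 → ∀ u : ℂ × ℂ, u.1.re = 0 → u.2.re = 0 →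
    ∫ ξ : ℝ × ℝ, Complex.exp (u.1 * (ξ.1 : ℂ) + u.2 * (ξ.2 : ℂ)) ∂(P t x)
      = Complex.exp ((x.1 : ℂ) * V₁ t u
          + (x.2 : ℂ) * (Complex.exp (-(b₂ : ℂ) * (t : ℂ)) * u.2)
          + ∫ s in (0:ℝ)..t,
              psi a₂ b₀ σ n (V₁ s u, Complex.exp (-(b₂ : ℂ) * (s : ℂ)) * u.2))

/-- A stationary (invariant) distribution for the semigroup `P` on `G = ℝ₊ × ℝ`. -/
def IsStationary (P : ℝ → ℝ × ℝ → Measure (ℝ × ℝ)) (π : Measure (ℝ × ℝ)) : Prop :=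
  IsProbabilityMeasure π ∧ π {x : ℝ × ℝ | x.1 < 0} = 0 ∧ ∀ t, 0 ≤ t → π.bind (P t) = π

/-- Defining properties of the minimal solution `v̄` of `(d/dt) v̄_t = -φ₀(v̄_t)`,
`v̄_{0+} = ∞`. -/
def IsVbar (a₁ α₁₁ α₁₂ : ℝ) (m : Measure (ℝ × ℝ)) (v : ℝ → ℝ) : Prop :=
  (∀ t > (0 : ℝ), 0 < v t) ∧
  (∀ t > (0 : ℝ), HasDerivAt v (-(phi0 a₁ α₁₁ α₁₂ m (v t))) t) ∧
  Tendsto v (𝓝[>] (0 : ℝ)) atTop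

open scoped ComplexConjugate

/-- `‖e^z - 1‖ ≤ ‖z‖` on the closed left half-plane. -/
lemma norm_exp_sub_one_le_norm_of_re_nonpos {z : ℂ} (hz : z.re ≤ 0) :
    ‖Complex.exp z - 1‖ ≤ ‖z‖ := by
  have hconv : Convex ℝ {w : ℂ | w.re ≤ 0} := convex_halfSpace_re_le 0
  have h := hconv.norm_image_sub_le_of_norm_hasDerivWithin_le (f := Complex.exp)
    (f' := Complex.exp) (C := 1) (x := 0) (y := z)
    (fun w _ => (Complex.hasDerivAt_exp w).hasDerivWithinAt)
    (fun w hw => by rw [Complex.norm_exp]; exact Real.exp_le_one_iff.2 hw)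
    (by simp) hz
  simpa using h

/-- `‖e^z - 1‖ ≤ 2` on the closed left half-plane. -/
lemma norm_exp_sub_one_le_two_of_re_nonpos {z : ℂ} (hz : z.re ≤ 0) :
    ‖Complex.exp z - 1‖ ≤ 2 := by
  have h : ‖Complex.exp z‖ ≤ 1 := by rw [Complex.norm_exp]; exact Real.exp_le_one_iff.2 hz
  calc ‖Complex.exp z - 1‖ ≤ ‖Complex.exp z‖ + ‖(1 : ℂ)‖ := norm_sub_le _ _
    _ ≤ 2 := by rw [norm_one]; linarith

/-- `‖e^z - 1 - z‖ ≤ ‖z‖²` on the closed left half-plane. -/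
lemma norm_exp_sub_one_sub_le_sq_of_re_nonpos {z : ℂ} (hz : z.re ≤ 0) :
    ‖Complex.exp z - 1 - z‖ ≤ ‖z‖ ^ 2 := by
  have hconv : Convex ℝ ({w : ℂ | w.re ≤ 0} ∩ Metric.closedBall 0 ‖z‖) :=
    (convex_halfSpace_re_le 0).inter (convex_closedBall 0 _)
  have h := hconv.norm_image_sub_le_of_norm_hasDerivWithin_le
    (f := fun w => Complex.exp w - w) (f' := fun w => Complex.exp w - 1) (C := ‖z‖)
    (x := 0) (y := z)
    (fun w _ => ((Complex.hasDerivAt_exp w).sub (hasDerivAt_id w)).hasDerivWithinAt)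
    (fun w hw => (norm_exp_sub_one_le_norm_of_re_nonpos hw.1).trans (by simpa using hw.2))
    (by simp) ⟨hz, by simp⟩
  have e : Complex.exp z - 1 - z = Complex.exp z - z - (Complex.exp 0 - 0) := by simp; ring
  rw [e, sq]
  simpa using h

lemma re_conj_mul_exp_sub_le {v w : ℂ} (hv : v.re ≤ 0) (hw : w.re = 0) {a : ℝ} (ha : 0 ≤ a)
    (b : ℝ) :
    (conj v * (Complex.exp (v * a + w * b) - 1 - (v * a + w * b))).re
      ≤ ‖v‖ * ‖w‖ ^ 2 * b ^ 2 := by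
  have hva : (v * a).re ≤ 0 := by simpa using mul_nonpos_of_nonpos_of_nonneg hv ha
  have hwb : (w * b).re = 0 := by simp [hw]
  have e : conj v * (Complex.exp (v * a + w * b) - 1 - (v * a + w * b))
      = conj v * (Complex.exp (w * b) * (Complex.exp (v * a) - 1))
        - ((‖v‖ ^ 2 * a : ℝ) : ℂ)
        + conj v * (Complex.exp (w * b) - 1 - w * b) := by
    have : ((‖v‖ ^ 2 * a : ℝ) : ℂ) = conj v * v * a := by
      rw [Complex.conj_mul']; push_cast; ring
    rw [this, Complex.exp_add]; ring
  have h1 : (conj v * (Complex.exp (w * b) * (Complex.exp (v * a) - 1))).re ≤ ‖v‖ ^ 2 * a := by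
    refine (Complex.re_le_norm _).trans ?_
    rw [norm_mul, norm_mul, Complex.norm_exp, hwb, Real.exp_zero, one_mul, Complex.norm_conj, sq,
      mul_assoc]
    gcongr
    refine (norm_exp_sub_one_le_norm_of_re_nonpos hva).trans ?_
    rw [norm_mul, Complex.norm_real, Real.norm_of_nonneg ha]
  have h2 : (conj v * (Complex.exp (w * b) - 1 - w * b)).re ≤ ‖v‖ * ‖w‖ ^ 2 * b ^ 2 := by
    refine (Complex.re_le_norm _).trans ?_
    rw [norm_mul, Complex.norm_conj, mul_assoc]
    gcongr
    refine (norm_exp_sub_one_sub_le_sq_of_re_nonpos hwb.le).trans ?_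
    rw [norm_mul, Complex.norm_real, mul_pow, Real.norm_eq_abs, sq_abs]
  rw [e, Complex.add_re, Complex.sub_re, Complex.ofReal_re]
  linarith

/-- The `z`-integrand of `ψ` is dominated, on `U`, by small jumps, large first-coordinate jumps
and the second coordinate. -/
lemma norm_exp_sub_one_sub_snd_le {v w : ℂ} (hv : v.re ≤ 0) (hw : w.re = 0) {a : ℝ} (ha : 0 ≤ a)
    (b : ℝ) :
    ‖Complex.exp (v * a + w * b) - 1 - b * w‖
      ≤ min 2 (‖v‖ * a) + (2 * ‖w‖ + ‖w‖ ^ 2) * min |b| (b ^ 2) := by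
  have hva : (v * a).re ≤ 0 := by simpa using mul_nonpos_of_nonpos_of_nonneg hv ha
  have hwb : (w * b).re = 0 := by simp [hw]
  have e : Complex.exp (v * a + w * b) - 1 - b * w
      = Complex.exp (w * b) * (Complex.exp (v * a) - 1)
        + (Complex.exp (w * b) - 1 - w * b) := by rw [Complex.exp_add]; ring
  rw [e]
  refine (norm_add_le _ _).trans (add_le_add ?_ ?_)
  · rw [norm_mul, Complex.norm_exp, hwb, Real.exp_zero, one_mul]
    refine le_min (norm_exp_sub_one_le_two_of_re_nonpos hva) ?_
    refine (norm_exp_sub_one_le_norm_of_re_nonpos hva).trans ?_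
    rw [norm_mul, Complex.norm_real, Real.norm_of_nonneg ha]
  · have hn : ‖w * b‖ = ‖w‖ * |b| := by rw [norm_mul, Complex.norm_real, Real.norm_eq_abs]
    rcases min_cases |b| (b ^ 2) with ⟨h, _⟩ | ⟨h, _⟩ <;> rw [h]
    · have h1 := norm_sub_le (Complex.exp (w * b) - 1) (w * b)
      have h2 := norm_exp_sub_one_le_norm_of_re_nonpos hwb.le
      have : 0 ≤ ‖w‖ ^ 2 * |b| := by positivity
      rw [hn] at h1 h2
      linarith
    · have h1 := norm_exp_sub_one_sub_le_sq_of_re_nonpos hwb.le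
      rw [hn, mul_pow, sq_abs] at h1
      have : 0 ≤ 2 * ‖w‖ * b ^ 2 := by positivity
      linarith

/-- If `Re (conj f · f') ≤ -a ‖f‖² + D e^{-bt} ‖f‖` then `f` decays exponentially. -/
lemma norm_le_mul_exp_of_re_conj_mul_deriv_le {f f' : ℝ → ℂ} {a b c D M : ℝ}
    (hca : c < a) (hcb : c ≤ b) (hD : 0 ≤ D)
    (hf : ∀ t, 0 ≤ t → HasDerivAt f (f' t) t)
    (hf' : ∀ t, 0 ≤ t →
      (conj (f t) * f' t).re ≤ -a * ‖f t‖ ^ 2 + ‖f t‖ * (D * Real.exp (-b * t)))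
    (h0 : ‖f 0‖ ≤ M) (hM : D < (a - c) * M) {t : ℝ} (ht : 0 ≤ t) :
    ‖f t‖ ≤ M * Real.exp (-c * t) := by
  have hM0 : 0 < M := by
    by_contra h
    have : (a - c) * M ≤ 0 := mul_nonpos_of_nonneg_of_nonpos (by linarith) (by linarith)
    linarith
  have hderiv : ∀ s, 0 ≤ s → HasDerivAt (fun s => ‖f s‖ ^ 2) (2 * (conj (f s) * f' s).re) s := by
    intro s hs
    have := (hf s hs).norm_sq
    convert this using 2
    rw [Complex.inner]
    congr 1
    ring
  have hB : ∀ s : ℝ, HasDerivAt (fun s => (M * Real.exp (-c * s)) ^ 2)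
      (2 * (M * Real.exp (-c * s)) * (M * (Real.exp (-c * s) * -c))) s := by
    intro s
    have h1 : HasDerivAt (fun s : ℝ => -c * s) (-c) s := by
      simpa using (hasDerivAt_id s).const_mul (-c)
    simpa using! (h1.exp.const_mul M).pow 2
  have key := image_le_of_deriv_right_lt_deriv_boundary (f := fun s => ‖f s‖ ^ 2)
    (f' := fun s => 2 * (conj (f s) * f' s).re) (a := 0) (b := t)
    (fun s hs => (hderiv s hs.1).continuousAt.continuousWithinAt)
    (fun s hs => (hderiv s hs.1).hasDerivWithinAt)
    (by simpa using pow_le_pow_left₀ (norm_nonneg _) h0 2) hB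
    (fun s hs hs' => by
      have hE : 0 < M * Real.exp (-c * s) := by positivity
      have hfs : ‖f s‖ = M * Real.exp (-c * s) :=
        (pow_left_inj₀ (norm_nonneg _) hE.le two_ne_zero).1 hs'
      have h1 := hf' s hs.1
      rw [hfs] at h1
      have h2 : D * Real.exp (-b * s) < (a - c) * M * Real.exp (-c * s) := by
        have : Real.exp (-b * s) ≤ Real.exp (-c * s) :=
          Real.exp_le_exp.2 (by nlinarith [hs.1])
        calc D * Real.exp (-b * s) ≤ D * Real.exp (-c * s) := by gcongr
          _ < _ := by gcongr
      have h3 := mul_lt_mul_of_pos_left h2 hE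
      nlinarith)
    (right_mem_Icc.2 ht)
  exact (pow_le_pow_iff_left₀ (norm_nonneg _) (by positivity) two_ne_zero).1 key

/-- The domain `U = {Re u₁ ≤ 0} × iℝ`. -/
def leftDomain : Set (ℂ × ℂ) := {u | u.1.re ≤ 0 ∧ u.2.re = 0}

/-- A bound for the integrand in `ψ` that is integrable against `n`. -/
def jumpWeight (z : ℝ × ℝ) : ℝ := min 1 z.1 + min |z.2| (z.2 ^ 2)

/-- The contribution of the jumps with `z₁ ≥ 1` to the bound for `ψ`. -/
def largeJumpIntegral (n : Measure (ℝ × ℝ)) (r : ℝ) : ℝ :=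
  ∫ z in {z : ℝ × ℝ | 1 ≤ z.1}, min 2 (r * z.1) ∂n

lemma measurableSet_one_le_fst : MeasurableSet {z : ℝ × ℝ | 1 ≤ z.1} :=
  measurableSet_le measurable_const measurable_fst

namespace AffineSemigroup

variable (S : AffineSemigroup)

/-- The trajectory `s ↦ V(s, u)`. -/
def path (u : ℂ × ℂ) (s : ℝ) : ℂ × ℂ :=
  (S.V₁ s u, Complex.exp (-(S.b₂ : ℂ) * (s : ℂ)) * u.2)

/-- The function `ψ` of the semigroup. -/
def immigration (v : ℂ × ℂ) : ℂ := psi S.a₂ S.b₀ S.σ S.n v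

lemma ae_m_nonneg : ∀ᵐ z ∂S.m, 0 ≤ z.1 := by
  rw [ae_iff]
  exact measure_mono_null (fun z hz => Or.inl (not_le.1 hz)) S.m_supp

lemma ae_n_nonneg : ∀ᵐ z ∂S.n, 0 ≤ z.1 := by
  rw [ae_iff]
  exact measure_mono_null (fun z hz => Or.inl (not_le.1 hz)) S.n_supp

lemma integrable_m_snd_sq : Integrable (fun z : ℝ × ℝ => z.2 ^ 2) S.m := by
  refine ⟨by fun_prop, ?_⟩
  rw [hasFiniteIntegral_iff_ofReal (ae_of_all _ fun z => sq_nonneg _)]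
  refine (lintegral_mono_ae ?_).trans_lt S.m_int
  filter_upwards [S.ae_m_nonneg] with z hz
  exact ENNReal.ofReal_le_ofReal (le_add_of_nonneg_left (le_min hz (sq_nonneg _)))

lemma integrable_n_jumpWeight : Integrable jumpWeight S.n := by
  refine ⟨by unfold jumpWeight; fun_prop, ?_⟩
  rw [hasFiniteIntegral_iff_ofReal]
  · exact S.n_int
  · filter_upwards [S.ae_n_nonneg] with z hz
    exact add_nonneg (le_min zero_le_one hz) (le_min (abs_nonneg _) (sq_nonneg _))

lemma isFiniteMeasure_restrict_n : IsFiniteMeasure (S.n.restrict {z : ℝ × ℝ | 1 ≤ z.1}) := by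
  refine ⟨?_⟩
  rw [Measure.restrict_apply_univ]
  refine lt_of_le_of_lt (measure_mono ?_)
    (S.integrable_n_jumpWeight.measure_norm_ge_lt_top zero_lt_one)
  intro z (hz : 1 ≤ z.1)
  have : 1 ≤ jumpWeight z := by
    rw [jumpWeight, min_eq_left hz]
    exact le_add_of_nonneg_right (le_min (abs_nonneg _) (sq_nonneg _))
  exact this.trans (le_abs_self _)

lemma re_conj_mul_phi_le {v : ℂ × ℂ} (hv : v ∈ leftDomain) :
    (conj v.1 * phi S.a₁ S.b₁ S.α₁₁ S.α₁₂ S.α₂₁ S.α₂₂ S.m v).re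
      ≤ -S.a₁ * ‖v.1‖ ^ 2 + ‖v.1‖ * (|S.b₁| * ‖v.2‖
          + (S.α₂₁ + S.α₂₂ + ∫ z : ℝ × ℝ, z.2 ^ 2 ∂S.m) * ‖v.2‖ ^ 2) := by
  obtain ⟨v, w⟩ := v
  obtain ⟨hv, hw⟩ := hv
  simp only at hv hw ⊢
  set F : ℝ × ℝ → ℂ := fun z => Complex.exp (v * (z.1 : ℂ) + w * (z.2 : ℂ)) - 1
          - (v * (z.1 : ℂ) + w * (z.2 : ℂ)) with hF
  have hintegral : (conj v * ∫ z, F z ∂S.m).re ≤ ‖v‖ * ‖w‖ ^ 2 * ∫ z : ℝ × ℝ, z.2 ^ 2 ∂S.m := by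
    by_cases hFi : Integrable F S.m
    · have hFi' := hFi.const_mul (conj v)
      rw [← integral_const_mul, ← integral_const_mul]
      have : (∫ z, conj v * F z ∂S.m).re = ∫ z, (conj v * F z).re ∂S.m :=
        (integral_re hFi').symm
      rw [this]
      refine integral_mono_ae hFi'.re (S.integrable_m_snd_sq.const_mul _) ?_
      filter_upwards [S.ae_m_nonneg] with z hz
      exact re_conj_mul_exp_sub_le hv hw hz z.2
    · rw [integral_undef hFi, mul_zero, Complex.zero_re]
      have : 0 ≤ ∫ z : ℝ × ℝ, z.2 ^ 2 ∂S.m := integral_nonneg fun z => sq_nonneg _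
      positivity
  have e : conj v * phi S.a₁ S.b₁ S.α₁₁ S.α₁₂ S.α₂₁ S.α₂₂ S.m (v, w)
      = ((-S.a₁ * ‖v‖ ^ 2 : ℝ) : ℂ) + -(S.b₁ : ℂ) * (conj v * w)
        + (((S.α₁₁ + S.α₁₂) * ‖v‖ ^ 2 : ℝ) : ℂ) * v
        + ((2 * (Real.sqrt (S.α₁₁ * S.α₂₁) + Real.sqrt (S.α₁₂ * S.α₂₂)) * ‖v‖ ^ 2 : ℝ) : ℂ) * w
        + ((S.α₂₁ + S.α₂₂ : ℝ) : ℂ) * (conj v * w ^ 2) + conj v * ∫ z, F z ∂S.m := by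
    have : ((‖v‖ : ℝ) : ℂ) ^ 2 = conj v * v := (Complex.conj_mul' v).symm
    push_cast
    rw [this, phi]
    ring
  have h1 : (-(S.b₁ : ℂ) * (conj v * w)).re ≤ ‖v‖ * (|S.b₁| * ‖w‖) := by
    refine (Complex.re_le_norm _).trans (le_of_eq ?_)
    rw [norm_mul, norm_mul, norm_neg, Complex.norm_real, Complex.norm_conj, Real.norm_eq_abs]
    ring
  have h2 : ((((S.α₁₁ + S.α₁₂) * ‖v‖ ^ 2 : ℝ) : ℂ) * v).re ≤ 0 := by
    rw [Complex.re_ofReal_mul]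
    exact mul_nonpos_of_nonneg_of_nonpos
      (mul_nonneg (add_nonneg S.α₁₁_nonneg S.α₁₂_nonneg) (sq_nonneg _)) hv
  have h3 : (((S.α₂₁ + S.α₂₂ : ℝ) : ℂ) * (conj v * w ^ 2)).re
      ≤ (S.α₂₁ + S.α₂₂) * (‖v‖ * ‖w‖ ^ 2) := by
    rw [Complex.re_ofReal_mul]
    refine mul_le_mul_of_nonneg_left ?_ (add_nonneg S.α₂₁_nonneg S.α₂₂_nonneg)
    refine (Complex.re_le_norm _).trans (le_of_eq ?_)
    rw [norm_mul, norm_pow, Complex.norm_conj]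
  rw [e]
  simp only [Complex.add_re]
  rw [Complex.ofReal_re, Complex.re_ofReal_mul _ w, hw, mul_zero]
  linarith

lemma norm_path_snd (u : ℂ × ℂ) (s : ℝ) :
    ‖(S.path u s).2‖ = Real.exp (-S.b₂ * s) * ‖u.2‖ := by
  simp [path, Complex.norm_exp]

lemma path_mem {u : ℂ × ℂ} (hu : u ∈ leftDomain) {s : ℝ} (hs : 0 ≤ s) :
    S.path u s ∈ leftDomain := by
  refine ⟨S.V₁_mem u hu.1 hu.2 s hs, ?_⟩
  have : Complex.exp (-(S.b₂ : ℂ) * (s : ℂ)) = ((Real.exp (-S.b₂ * s) : ℝ) : ℂ) := by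
    push_cast; rfl
  simp only [path]
  rw [this, Complex.re_ofReal_mul, hu.2, mul_zero]

lemma exists_norm_path_fst_le (ha₁ : 0 < S.a₁) (hb₂ : 0 < S.b₂) :
    ∃ c > 0, c ≤ S.b₂ ∧ ∃ K ≥ 0, ∀ u ∈ leftDomain, ∀ t, 0 ≤ t →
      ‖(S.path u t).1‖ ≤ K * (‖u‖ + ‖u‖ ^ 2) * Real.exp (-c * t) := by
  set c := min S.a₁ S.b₂ / 2 with hc
  have hmin : 0 < min S.a₁ S.b₂ := lt_min ha₁ hb₂
  have hc0 : 0 < c := by positivity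
  have hca : c < S.a₁ := by have := min_le_left S.a₁ S.b₂; linarith
  have hcb : c ≤ S.b₂ := by have := min_le_right S.a₁ S.b₂; linarith
  set K₀ := S.α₂₁ + S.α₂₂ + ∫ z : ℝ × ℝ, z.2 ^ 2 ∂S.m with hK₀
  have hK₀0 : 0 ≤ K₀ := by
    have : 0 ≤ ∫ z : ℝ × ℝ, z.2 ^ 2 ∂S.m := integral_nonneg fun z => sq_nonneg _
    have := S.α₂₁_nonneg
    have := S.α₂₂_nonneg
    positivity
  have hac : 0 < S.a₁ - c := by linarith
  refine ⟨c, hc0, hcb, 1 + (|S.b₁| + K₀) / (S.a₁ - c), by positivity, fun u hu t ht => ?_⟩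
  set D := (|S.b₁| + K₀) * (‖u‖ + ‖u‖ ^ 2) with hD
  have hD0 : 0 ≤ D := by positivity
  have hM : (1 + (|S.b₁| + K₀) / (S.a₁ - c)) * (‖u‖ + ‖u‖ ^ 2)
      = ‖u‖ + ‖u‖ ^ 2 + D / (S.a₁ - c) := by rw [hD]; ring
  refine le_of_forall_pos_le_add fun ε hε => ?_
  have key := norm_le_mul_exp_of_re_conj_mul_deriv_le (f := fun s => S.V₁ s u)
    (f' := fun s => phi S.a₁ S.b₁ S.α₁₁ S.α₁₂ S.α₂₁ S.α₂₂ S.m (S.path u s))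
    (a := S.a₁) (b := S.b₂) (c := c) (D := D)
    (M := (1 + (|S.b₁| + K₀) / (S.a₁ - c)) * (‖u‖ + ‖u‖ ^ 2) + ε) hca hcb hD0
    (fun s hs => S.V₁_ode u hu.1 hu.2 s hs)
    (fun s hs => by
      refine (S.re_conj_mul_phi_le (S.path_mem hu hs)).trans ?_
      rw [S.norm_path_snd]
      have hE : Real.exp (-S.b₂ * s) ≤ 1 := Real.exp_le_one_iff.2 (by nlinarith)
      have hE0 := (Real.exp_pos (-S.b₂ * s)).le
      have h2 : ‖u.2‖ ≤ ‖u‖ := norm_snd_le u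
      refine add_le_add le_rfl (mul_le_mul_of_nonneg_left ?_ (norm_nonneg _))
      calc |S.b₁| * (Real.exp (-S.b₂ * s) * ‖u.2‖) + K₀ * (Real.exp (-S.b₂ * s) * ‖u.2‖) ^ 2
          ≤ (|S.b₁| + K₀) * (Real.exp (-S.b₂ * s) * ‖u.2‖)
            + (|S.b₁| + K₀) * (Real.exp (-S.b₂ * s) * ‖u.2‖ ^ 2) := by
            rw [mul_pow]
            gcongr
            · linarith
            · linarith [abs_nonneg S.b₁]
            · nlinarith
        _ ≤ (|S.b₁| + K₀) * (Real.exp (-S.b₂ * s) * ‖u‖)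
            + (|S.b₁| + K₀) * (Real.exp (-S.b₂ * s) * ‖u‖ ^ 2) := by gcongr
        _ = D * Real.exp (-S.b₂ * s) := by rw [hD]; ring)
    (by
      rw [S.V₁_init, hM]
      have := norm_fst_le u
      have : 0 ≤ D / (S.a₁ - c) := by positivity
      nlinarith [sq_nonneg ‖u‖])
    (by
      have h1 : (S.a₁ - c) * (D / (S.a₁ - c)) = D := by field_simp
      have h2 : 0 ≤ (S.a₁ - c) * (‖u‖ + ‖u‖ ^ 2) := by positivity
      have h3 : 0 < (S.a₁ - c) * ε := by positivity
      rw [hM, mul_add, mul_add (S.a₁ - c), h1]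
      linarith)
    ht
  refine key.trans ?_
  have hE : Real.exp (-c * t) ≤ 1 := Real.exp_le_one_iff.2 (by nlinarith)
  rw [add_mul]
  gcongr
  nlinarith

lemma norm_jump_integrand_le {v : ℂ × ℂ} (hv : v ∈ leftDomain) {R : ℝ} (hR : ‖v‖ ≤ R)
    {z : ℝ × ℝ} (hz : 0 ≤ z.1) :
    ‖Complex.exp (v.1 * (z.1 : ℂ) + v.2 * (z.2 : ℂ)) - 1 - (z.2 : ℂ) * v.2‖
      ≤ (2 + R + (2 * R + R ^ 2)) * jumpWeight z := by
  have h1 := (norm_fst_le v).trans hR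
  have h2 := (norm_snd_le v).trans hR
  have hR0 : 0 ≤ R := (norm_nonneg _).trans hR
  have hA : 0 ≤ min 1 z.1 := le_min zero_le_one hz
  have hB : 0 ≤ min |z.2| (z.2 ^ 2) := le_min (abs_nonneg _) (sq_nonneg _)
  refine (norm_exp_sub_one_sub_snd_le hv.1 hv.2 hz z.2).trans ?_
  have h3 : min 2 (‖v.1‖ * z.1) ≤ (2 + R) * min 1 z.1 := by
    rcases min_cases 1 z.1 with ⟨h, _⟩ | ⟨h, _⟩ <;> rw [h]
    · exact (min_le_left _ _).trans (by linarith)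
    · exact (min_le_right _ _).trans (by gcongr; linarith)
  have h4 : (2 * ‖v.2‖ + ‖v.2‖ ^ 2) * min |z.2| (z.2 ^ 2)
      ≤ (2 * R + R ^ 2) * min |z.2| (z.2 ^ 2) := by gcongr
  rw [jumpWeight]
  nlinarith [mul_nonneg hR0 hA, mul_nonneg hR0 hB, mul_nonneg (sq_nonneg R) hA]

lemma continuousOn_immigration : ContinuousOn S.immigration leftDomain := by
  have hI : ContinuousOn (fun v : ℂ × ℂ => ∫ z : ℝ × ℝ,
      (Complex.exp (v.1 * (z.1 : ℂ) + v.2 * (z.2 : ℂ)) - 1 - (z.2 : ℂ) * v.2) ∂S.n)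
      leftDomain := by
    intro v₀ _
    refine continuousWithinAt_of_dominated
      (bound := fun z => (2 + (‖v₀‖ + 1) + (2 * (‖v₀‖ + 1) + (‖v₀‖ + 1) ^ 2)) * jumpWeight z)
      ?_ ?_ (S.integrable_n_jumpWeight.const_mul _) ?_
    · exact .of_forall fun v => by
        refine Continuous.aestronglyMeasurable ?_
        fun_prop
    · have hev : ∀ᶠ v in 𝓝[leftDomain] v₀, ‖v‖ < ‖v₀‖ + 1 :=
        nhdsWithin_le_nhds (continuous_norm.continuousAt.eventually_lt_const (by simp))
      filter_upwards [hev, self_mem_nhdsWithin] with v hv hvU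
      filter_upwards [S.ae_n_nonneg] with z hz
      exact norm_jump_integrand_le hvU hv.le hz
    · exact ae_of_all _ fun z => Continuous.continuousWithinAt (by fun_prop)
  have hP : Continuous fun v : ℂ × ℂ =>
    (S.a₂ : ℂ) * v.1 - (S.b₀ : ℂ) * v.2 + (S.σ : ℂ) ^ 2 / 2 * v.2 ^ 2 := by fun_prop
  exact hP.continuousOn.add hI

lemma integrable_largeJump (r : ℝ) (hr : 0 ≤ r) :
    Integrable (fun z : ℝ × ℝ => min 2 (r * z.1)) (S.n.restrict {z : ℝ × ℝ | 1 ≤ z.1}) := by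
  have := S.isFiniteMeasure_restrict_n
  refine (integrable_const (2 : ℝ)).mono' (by fun_prop) ?_
  filter_upwards [ae_restrict_mem measurableSet_one_le_fst] with z hz
  have hz' : (1 : ℝ) ≤ z.1 := hz
  rw [Real.norm_of_nonneg (le_min zero_le_two (by positivity))]
  exact min_le_left _ _

lemma largeJumpIntegral_mono {r r' : ℝ} (hr : 0 ≤ r) (hrr' : r ≤ r') :
    largeJumpIntegral S.n r ≤ largeJumpIntegral S.n r' := by
  refine setIntegral_mono_on (S.integrable_largeJump r hr)
    (S.integrable_largeJump r' (hr.trans hrr')) measurableSet_one_le_fst fun z hz => ?_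
  have hz' : (1 : ℝ) ≤ z.1 := hz
  gcongr

lemma norm_immigration_le {v : ℂ × ℂ} (hv : v ∈ leftDomain) :
    ‖S.immigration v‖ ≤ S.a₂ * ‖v.1‖ + |S.b₀| * ‖v.2‖ + S.σ ^ 2 / 2 * ‖v.2‖ ^ 2
      + (‖v.1‖ + (2 * ‖v.2‖ + ‖v.2‖ ^ 2)) * (∫ z, jumpWeight z ∂S.n)
      + largeJumpIntegral S.n ‖v.1‖ := by
  have hind : Integrable ({z : ℝ × ℝ | 1 ≤ z.1}.indicator
      fun z : ℝ × ℝ => min 2 (‖v.1‖ * z.1)) S.n :=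
    (integrable_indicator_iff measurableSet_one_le_fst).2
      (S.integrable_largeJump _ (norm_nonneg _))
  have hI : ‖∫ z : ℝ × ℝ,
      (Complex.exp (v.1 * (z.1 : ℂ) + v.2 * (z.2 : ℂ)) - 1 - (z.2 : ℂ) * v.2) ∂S.n‖
      ≤ (‖v.1‖ + (2 * ‖v.2‖ + ‖v.2‖ ^ 2)) * (∫ z, jumpWeight z ∂S.n)
        + largeJumpIntegral S.n ‖v.1‖ := by
    rw [largeJumpIntegral, ← integral_indicator measurableSet_one_le_fst, ← integral_const_mul,
      ← integral_add (S.integrable_n_jumpWeight.const_mul _) hind]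
    refine norm_integral_le_of_norm_le ((S.integrable_n_jumpWeight.const_mul _).add hind) ?_
    filter_upwards [S.ae_n_nonneg] with z hz
    refine (norm_exp_sub_one_sub_snd_le hv.1 hv.2 hz z.2).trans ?_
    have hA : 0 ≤ min 1 z.1 := le_min zero_le_one hz
    have hB : 0 ≤ min |z.2| (z.2 ^ 2) := le_min (abs_nonneg _) (sq_nonneg _)
    have hP : 0 ≤ (2 * ‖v.2‖ + ‖v.2‖ ^ 2) * min 1 z.1 := by positivity
    have hQ : 0 ≤ ‖v.1‖ * min |z.2| (z.2 ^ 2) := by positivity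
    have h : min 2 (‖v.1‖ * z.1) ≤ ‖v.1‖ * min 1 z.1
        + {z : ℝ × ℝ | 1 ≤ z.1}.indicator (fun z : ℝ × ℝ => min 2 (‖v.1‖ * z.1)) z := by
      by_cases h1 : 1 ≤ z.1
      · rw [indicator_of_mem (show z ∈ {z : ℝ × ℝ | 1 ≤ z.1} from h1)]
        exact le_add_of_nonneg_left (by positivity)
      · rw [indicator_of_notMem (show z ∉ {z : ℝ × ℝ | 1 ≤ z.1} from h1), add_zero,
          min_eq_right (a := 1) (le_of_not_ge h1)]
        exact min_le_right _ _
    rw [jumpWeight]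
    linarith
  have hP : ‖(S.a₂ : ℂ) * v.1 - (S.b₀ : ℂ) * v.2 + (S.σ : ℂ) ^ 2 / 2 * v.2 ^ 2‖
      ≤ S.a₂ * ‖v.1‖ + |S.b₀| * ‖v.2‖ + S.σ ^ 2 / 2 * ‖v.2‖ ^ 2 := by
    refine (norm_add_le _ _).trans (add_le_add ((norm_sub_le _ _).trans (le_of_eq ?_))
      (le_of_eq ?_))
    · rw [norm_mul, norm_mul, Complex.norm_real, Complex.norm_real, Real.norm_eq_abs,
        Real.norm_eq_abs, abs_of_nonneg S.a₂_nonneg]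
    · simp
  rw [immigration, psi]
  exact (norm_add_le _ _).trans (by linarith)

lemma lintegral_min_two_mul_exp_le {c M a : ℝ} (hc : 0 < c) (hM : 0 ≤ M) (ha : 1 ≤ a) :
    ∫⁻ s in Ioi (0 : ℝ), ENNReal.ofReal (min 2 (M * Real.exp (-c * s) * a))
      ≤ ENNReal.ofReal (2 / c) * ENNReal.ofReal (Real.log a) + ENNReal.ofReal (M / c) := by
  have hT : 0 ≤ Real.log a / c := div_nonneg (Real.log_nonneg ha) hc.le
  have ha0 : 0 < a := by linarith
  rw [← Ioc_union_Ioi_eq_Ioi hT]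
  refine (lintegral_union_le _ _ _).trans (add_le_add ?_ ?_)
  · calc ∫⁻ s in Ioc 0 (Real.log a / c), ENNReal.ofReal (min 2 (M * Real.exp (-c * s) * a))
        ≤ ∫⁻ _ in Ioc 0 (Real.log a / c), ENNReal.ofReal 2 :=
          lintegral_mono fun s => ENNReal.ofReal_le_ofReal (min_le_left _ _)
      _ = ENNReal.ofReal (2 / c) * ENNReal.ofReal (Real.log a) := by
          rw [setLIntegral_const, Real.volume_Ioc, sub_zero, ← ENNReal.ofReal_mul zero_le_two,
            ← ENNReal.ofReal_mul (by positivity)]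
          congr 1
          ring
  · have hi := (integrableOn_exp_mul_Ioi (neg_lt_zero.2 hc) (Real.log a / c)).const_mul (M * a)
    calc ∫⁻ s in Ioi (Real.log a / c), ENNReal.ofReal (min 2 (M * Real.exp (-c * s) * a))
        ≤ ∫⁻ s in Ioi (Real.log a / c), ENNReal.ofReal (M * a * Real.exp (-c * s)) :=
          lintegral_mono fun s => ENNReal.ofReal_le_ofReal
            ((min_le_right _ _).trans (le_of_eq (by ring)))
      _ = ENNReal.ofReal (M / c) := by
          rw [← ofReal_integral_eq_lintegral_ofReal hi (ae_of_all _ fun s => by positivity),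
            integral_const_mul, integral_exp_mul_Ioi (neg_lt_zero.2 hc)]
          congr 1
          have : Real.exp (-c * (Real.log a / c)) = a⁻¹ := by
            rw [← Real.exp_log ha0, ← Real.exp_neg, Real.log_exp]
            congr 1
            field_simp
          rw [this]
          field_simp

lemma integrableOn_largeJumpIntegral_exp
    (hlog : ∫⁻ z in {z : ℝ × ℝ | 1 ≤ z.1}, ENNReal.ofReal (Real.log z.1) ∂S.n < ⊤)
    {c M : ℝ} (hc : 0 < c) (hM : 0 ≤ M) :
    IntegrableOn (fun s => largeJumpIntegral S.n (M * Real.exp (-c * s))) (Ioi 0) := by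
  have hfin := S.isFiniteMeasure_restrict_n
  set ν := S.n.restrict {z : ℝ × ℝ | 1 ≤ z.1}
  have hprod : Integrable
      (fun q : ℝ × ℝ × ℝ => min 2 (M * Real.exp (-c * q.1) * q.2.1))
      ((volume.restrict (Ioi (0 : ℝ))).prod ν) := by
    refine ⟨Continuous.aestronglyMeasurable (by fun_prop), ?_⟩
    rw [hasFiniteIntegral_iff_enorm, lintegral_prod_symm _ (by fun_prop)]
    have hle : ∀ᵐ z ∂ν, ∫⁻ s in Ioi (0 : ℝ), ‖min 2 (M * Real.exp (-c * s) * z.1)‖ₑ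
        ≤ ENNReal.ofReal (2 / c) * ENNReal.ofReal (Real.log z.1) + ENNReal.ofReal (M / c) := by
      filter_upwards [ae_restrict_mem measurableSet_one_le_fst] with z hz
      have hz' : (1 : ℝ) ≤ z.1 := hz
      refine (lintegral_mono fun s => ?_).trans (lintegral_min_two_mul_exp_le hc hM hz')
      rw [Real.enorm_of_nonneg (le_min zero_le_two (by positivity))]
    refine (lintegral_mono_ae hle).trans_lt ?_
    rw [lintegral_add_right _ measurable_const, lintegral_const_mul' _ _ ENNReal.ofReal_ne_top,
      lintegral_const]
    exact ENNReal.add_lt_top.2 ⟨ENNReal.mul_lt_top ENNReal.ofReal_lt_top hlog,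
      ENNReal.mul_lt_top ENNReal.ofReal_lt_top (measure_lt_top ν _)⟩
  exact hprod.integral_prod_left

variable {S}

lemma tendsto_path (ha₁ : 0 < S.a₁) (hb₂ : 0 < S.b₂) {u : ℂ × ℂ} (hu : u ∈ leftDomain) :
    Tendsto (S.path u) atTop (𝓝 0) := by
  obtain ⟨c, hc, -, K, -, hle⟩ := S.exists_norm_path_fst_le ha₁ hb₂
  have hexp : ∀ b : ℝ, 0 < b → Tendsto (fun t : ℝ => Real.exp (-b * t)) atTop (𝓝 0) := by
    intro b hb
    refine Real.tendsto_exp_atBot.comp ?_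
    exact tendsto_id.const_mul_atTop_of_neg (neg_lt_zero.2 hb)
  have h1 : Tendsto (fun t => (S.path u t).1) atTop (𝓝 0) := by
    refine squeeze_zero_norm' (a := fun t => K * (‖u‖ + ‖u‖ ^ 2) * Real.exp (-c * t)) ?_ ?_
    · filter_upwards [eventually_ge_atTop 0] with t ht using hle u hu t ht
    · simpa using (hexp c hc).const_mul (K * (‖u‖ + ‖u‖ ^ 2))
  have h2 : Tendsto (fun t => (S.path u t).2) atTop (𝓝 0) := by
    rw [tendsto_zero_iff_norm_tendsto_zero]
    simp_rw [S.norm_path_snd]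
    simpa using (hexp S.b₂ hb₂).mul_const ‖u.2‖
  exact h1.prodMk_nhds h2

lemma exists_integrableOn_bound (ha₁ : 0 < S.a₁) (hb₂ : 0 < S.b₂)
    (hlog : ∫⁻ z in {z : ℝ × ℝ | 1 ≤ z.1}, ENNReal.ofReal (Real.log z.1) ∂S.n < ⊤) (R : ℝ) :
    ∃ B : ℝ → ℝ, IntegrableOn B (Ioi 0) ∧ ∀ u ∈ leftDomain, ‖u‖ ≤ R → ∀ s, 0 ≤ s →
      ‖S.immigration (S.path u s)‖ ≤ B s := by
  obtain ⟨c, hc, hcb, K, hK, hle⟩ := S.exists_norm_path_fst_le ha₁ hb₂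
  rcases lt_or_ge R 0 with hR | hR
  · exact ⟨0, integrableOn_zero, fun u _ h => absurd ((norm_nonneg u).trans h) hR.not_ge⟩
  set M := K * (R + R ^ 2) with hMdef
  have hM : 0 ≤ M := by positivity
  set N := ∫ z, jumpWeight z ∂S.n with hN
  have hN0 : 0 ≤ N := integral_nonneg_of_ae (by
    filter_upwards [S.ae_n_nonneg] with z hz
    exact add_nonneg (le_min zero_le_one hz) (le_min (abs_nonneg _) (sq_nonneg _)))
  refine ⟨fun s => (S.a₂ * M + |S.b₀| * R + S.σ ^ 2 / 2 * R ^ 2 + (M + (2 * R + R ^ 2)) * N)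
    * Real.exp (-c * s) + largeJumpIntegral S.n (M * Real.exp (-c * s)),
    Integrable.fun_add ((integrableOn_exp_mul_Ioi (neg_lt_zero.2 hc) 0).const_mul _)
      (S.integrableOn_largeJumpIntegral_exp hlog hc hM), fun u hu huR s hs => ?_⟩
  set E := Real.exp (-c * s) with hE
  have hE0 : 0 ≤ E := (Real.exp_pos _).le
  have hE1 : E ≤ 1 := Real.exp_le_one_iff.2 (by nlinarith)
  have h1 : ‖(S.path u s).1‖ ≤ M * E := (hle u hu s hs).trans (by rw [hMdef]; gcongr)
  have h2 : ‖(S.path u s).2‖ ≤ R * E := by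
    rw [S.norm_path_snd, mul_comm R]
    have : Real.exp (-S.b₂ * s) ≤ E := Real.exp_le_exp.2 (by nlinarith)
    have := (norm_snd_le u).trans huR
    gcongr
  have h2' : ‖(S.path u s).2‖ ^ 2 ≤ R ^ 2 * E := by
    calc ‖(S.path u s).2‖ ^ 2 ≤ (R * E) ^ 2 := by gcongr
      _ = R ^ 2 * (E * E) := by ring
      _ ≤ R ^ 2 * (E * 1) := by gcongr
      _ = R ^ 2 * E := by ring
  have ha₂ := S.a₂_nonneg
  calc ‖S.immigration (S.path u s)‖
      ≤ S.a₂ * ‖(S.path u s).1‖ + |S.b₀| * ‖(S.path u s).2‖ + S.σ ^ 2 / 2 * ‖(S.path u s).2‖ ^ 2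
        + (‖(S.path u s).1‖ + (2 * ‖(S.path u s).2‖ + ‖(S.path u s).2‖ ^ 2)) * N
        + largeJumpIntegral S.n ‖(S.path u s).1‖ := S.norm_immigration_le (S.path_mem hu hs)
    _ ≤ S.a₂ * (M * E) + |S.b₀| * (R * E) + S.σ ^ 2 / 2 * (R ^ 2 * E)
        + (M * E + (2 * (R * E) + R ^ 2 * E)) * N + largeJumpIntegral S.n (M * E) := by
        gcongr
        exact S.largeJumpIntegral_mono (norm_nonneg _) h1
    _ = _ := by ring

lemma aestronglyMeasurable_immigration_path {u : ℂ × ℂ} (hu : u ∈ leftDomain) :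
    AEStronglyMeasurable (fun s => S.immigration (S.path u s)) (volume.restrict (Ioi 0)) := by
  refine ContinuousOn.aestronglyMeasurable ?_ measurableSet_Ioi
  refine S.continuousOn_immigration.comp (fun s hs => ?_)
    (fun s hs => S.path_mem hu (le_of_lt hs))
  have h1 : ContinuousAt (fun s => S.V₁ s u) s :=
    (S.V₁_ode u hu.1 hu.2 s (le_of_lt hs)).continuousAt
  have h2 : Continuous fun s : ℝ => Complex.exp (-(S.b₂ : ℂ) * (s : ℂ)) * u.2 := by fun_prop
  exact (h1.prodMk h2.continuousAt).continuousWithinAt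

lemma integrableOn_immigration_path (ha₁ : 0 < S.a₁) (hb₂ : 0 < S.b₂)
    (hlog : ∫⁻ z in {z : ℝ × ℝ | 1 ≤ z.1}, ENNReal.ofReal (Real.log z.1) ∂S.n < ⊤)
    {u : ℂ × ℂ} (hu : u ∈ leftDomain) :
    IntegrableOn (fun s => S.immigration (S.path u s)) (Ioi 0) := by
  obtain ⟨B, hB, hle⟩ := exists_integrableOn_bound ha₁ hb₂ hlog ‖u‖
  refine Integrable.mono' hB (aestronglyMeasurable_immigration_path hu) ?_
  filter_upwards [ae_restrict_mem measurableSet_Ioi] with s hs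
  exact hle u hu le_rfl s (le_of_lt hs)

lemma continuousWithinAt_integral_immigration (ha₁ : 0 < S.a₁) (hb₂ : 0 < S.b₂)
    (hlog : ∫⁻ z in {z : ℝ × ℝ | 1 ≤ z.1}, ENNReal.ofReal (Real.log z.1) ∂S.n < ⊤) :
    ContinuousWithinAt (fun u => ∫ s in Ioi 0, S.immigration (S.path u s)) leftDomain 0 := by
  obtain ⟨B, hB, hle⟩ := exists_integrableOn_bound ha₁ hb₂ hlog 1
  have h0 : (0 : ℂ × ℂ) ∈ leftDomain := by simp [leftDomain]
  refine tendsto_integral_filter_of_dominated_convergence B ?_ ?_ hB ?_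
  · filter_upwards [self_mem_nhdsWithin] with u hu using aestronglyMeasurable_immigration_path hu
  · have hev : ∀ᶠ u : ℂ × ℂ in 𝓝[leftDomain] 0, ‖u‖ < 1 :=
      nhdsWithin_le_nhds (continuous_norm.continuousAt.eventually_lt_const (by simp))
    filter_upwards [self_mem_nhdsWithin, hev] with u hu hu1
    filter_upwards [ae_restrict_mem measurableSet_Ioi] with s hs
    exact hle u hu hu1.le s (le_of_lt hs)
  · filter_upwards [ae_restrict_mem measurableSet_Ioi] with s hs
    have hs0 : (0 : ℝ) ≤ s := le_of_lt hs
    obtain ⟨c, -, -, K, -, hK⟩ := S.exists_norm_path_fst_le ha₁ hb₂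
    have hpath : ContinuousWithinAt (fun u => S.path u s) leftDomain 0 := by
      have h1 : ContinuousWithinAt (fun u => (S.path u s).1) leftDomain 0 := by
        have hz : (S.path 0 s).1 = 0 := by simpa using hK 0 h0 s hs0
        rw [ContinuousWithinAt, hz]
        refine squeeze_zero_norm'
          (a := fun u => K * (‖u‖ + ‖u‖ ^ 2) * Real.exp (-c * s)) ?_ ?_
        · filter_upwards [self_mem_nhdsWithin] with u hu using hK u hu s hs0
        · have : Continuous fun u : ℂ × ℂ => K * (‖u‖ + ‖u‖ ^ 2) * Real.exp (-c * s) := by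
            fun_prop
          simpa using (this.tendsto 0).mono_left nhdsWithin_le_nhds
      have h2 : Continuous fun u : ℂ × ℂ => (S.path u s).2 := by
        unfold path
        fun_prop
      exact h1.prodMk h2.continuousWithinAt
    exact ContinuousWithinAt.comp (f := fun u => S.path u s) (x := 0)
      (S.continuousOn_immigration _ (S.path_mem h0 hs0)) hpath fun u hu => S.path_mem hu hs0

end AffineSemigroup

lemma integral_bind {α β : Type*} [MeasurableSpace α] [MeasurableSpace β] {μ : Measure α}
    {κ : α → Measure β} (hκ : Measurable κ) (hprob : ∀ᵐ x ∂μ, IsProbabilityMeasure (κ x))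
    {f : β → ℂ} (hf : Integrable f (μ.bind κ)) :
    ∫ y, f y ∂(μ.bind κ) = ∫ x, ∫ y, f y ∂(κ x) ∂μ := by
  have hset : MeasurableSet {x | κ x univ = 1} :=
    (Measure.measurable_coe MeasurableSet.univ).comp hκ (measurableSet_singleton 1)
  let η : ProbabilityTheory.Kernel α β :=
    ⟨fun x => if κ x univ = 1 then κ x else 0, Measurable.ite hset hκ measurable_const⟩
  have hη : ∀ x, η x = if κ x univ = 1 then κ x else 0 := fun _ => rfl
  have hfin : ProbabilityTheory.IsFiniteKernel η := by
    refine ⟨1, ENNReal.one_lt_top, fun x => ?_⟩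
    rw [hη]
    split_ifs with h <;> simp [h]
  have hae : κ =ᵐ[μ] η := by
    filter_upwards [hprob] with x hx
    rw [hη, if_pos hx.measure_univ]
  have hcomp : (η.comp (ProbabilityTheory.Kernel.const Unit μ)) () = μ.bind η := by
    rw [ProbabilityTheory.Kernel.comp_apply, ProbabilityTheory.Kernel.const_apply]
  rw [Measure.bind_congr_right hae, ← hcomp] at hf ⊢
  rw [ProbabilityTheory.Kernel.integral_comp hf, ProbabilityTheory.Kernel.const_apply]
  refine integral_congr_ae ?_
  filter_upwards [hae] with x hx
  rw [hx]

lemma isProbabilityMeasure_bind {α β : Type*} [MeasurableSpace α] [MeasurableSpace β]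
    {μ : Measure α} [IsProbabilityMeasure μ] {κ : α → Measure β} (hκ : Measurable κ)
    (hprob : ∀ᵐ x ∂μ, IsProbabilityMeasure (κ x)) : IsProbabilityMeasure (μ.bind κ) := by
  constructor
  rw [Measure.bind_apply MeasurableSet.univ hκ.aemeasurable]
  calc ∫⁻ x, κ x univ ∂μ = ∫⁻ _, 1 ∂μ :=
        lintegral_congr_ae (by filter_upwards [hprob] with x hx using hx.measure_univ)
    _ = 1 := by simp

lemma exists_charFun_eq_of_tendsto {E : Type*} [NormedAddCommGroup E] [InnerProductSpace ℝ E]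
    [FiniteDimensional ℝ E] [MeasurableSpace E] [BorelSpace E] {μ : ℕ → ProbabilityMeasure E}
    {f : E → ℂ} (hf : ContinuousAt f 0)
    (h : ∀ t, Tendsto (fun k => charFun (μ k : Measure E) t) atTop (𝓝 (f t))) :
    ∃ π : ProbabilityMeasure E, charFun (π : Measure E) = f := by
  have htight : IsTightMeasureSet (range fun k => (μ k : Measure E)) :=
    isTightMeasureSet_of_tendsto_charFun hf h
  have hcompact : IsCompact (closure (range μ)) :=
    isCompact_closure_of_isTightMeasureSet
      (by simpa [range] using htight)
  obtain ⟨π, -, hπ : Tendsto _ _ _⟩ :=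
    hcompact.ultrafilter_le_nhds ((hyperfilter ℕ).map μ)
      (.trans (by simp) (monotone_principal subset_closure))
  refine ⟨π, funext fun t => tendsto_nhds_unique ?_ ((h t).mono_left Nat.hyperfilter_le_atTop)⟩
  rw [ProbabilityMeasure.tendsto_iff_forall_integral_rclike_tendsto ℂ] at hπ
  simp_rw [charFun_eq_integral_innerProbChar]
  exact hπ (BoundedContinuousFunction.innerProbChar t)

/-- The embedding `ℝ² → iℝ²`. -/
def imagPair (p : ℝ × ℝ) : ℂ × ℂ := (p.1 * Complex.I, p.2 * Complex.I)

/-- The integral `∫ e^{⟨u,ξ⟩} μ(dξ)`. -/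
def expIntegral (μ : Measure (ℝ × ℝ)) (u : ℂ × ℂ) : ℂ :=
  ∫ ξ : ℝ × ℝ, Complex.exp (u.1 * (ξ.1 : ℂ) + u.2 * (ξ.2 : ℂ)) ∂μ

lemma exists_eq_imagPair {u : ℂ × ℂ} (h1 : u.1.re = 0) (h2 : u.2.re = 0) :
    ∃ p, u = imagPair p :=
  ⟨(u.1.im, u.2.im), by
    refine Prod.ext (Complex.ext ?_ ?_) (Complex.ext ?_ ?_) <;> simp [imagPair, h1, h2]⟩

lemma imagPair_mem (p : ℝ × ℝ) : imagPair p ∈ leftDomain := by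
  simp [imagPair, leftDomain]

lemma norm_exp_imagPair (p ξ : ℝ × ℝ) :
    ‖Complex.exp ((imagPair p).1 * (ξ.1 : ℂ) + (imagPair p).2 * (ξ.2 : ℂ))‖ = 1 := by
  rw [Complex.norm_exp]
  simp [imagPair]

lemma integrable_exp_imagPair (μ : Measure (ℝ × ℝ)) [IsFiniteMeasure μ] (p : ℝ × ℝ) :
    Integrable
      (fun ξ : ℝ × ℝ => Complex.exp ((imagPair p).1 * (ξ.1 : ℂ) + (imagPair p).2 * (ξ.2 : ℂ)))
      μ :=
  .of_bound (Continuous.aestronglyMeasurable (by fun_prop)) 1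
    (ae_of_all _ fun ξ => (norm_exp_imagPair p ξ).le)

lemma norm_expIntegral_le_one (μ : Measure (ℝ × ℝ)) [IsProbabilityMeasure μ] (p : ℝ × ℝ) :
    ‖expIntegral μ (imagPair p)‖ ≤ 1 := by
  rw [expIntegral]
  simpa using norm_integral_le_of_norm_le_const (μ := μ)
    (ae_of_all _ fun ξ => (norm_exp_imagPair p ξ).le)

lemma charFun_map_toLp (μ : Measure (ℝ × ℝ)) (t : WithLp 2 (ℝ × ℝ)) :
    charFun (μ.map (WithLp.toLp 2)) t = expIntegral μ (imagPair t.ofLp) := by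
  rw [charFun_apply, integral_map (by fun_prop) (Continuous.aestronglyMeasurable (by fun_prop)),
    expIntegral]
  refine integral_congr_ae (ae_of_all _ fun ξ => ?_)
  simp only [WithLp.prod_inner_apply, imagPair]
  congr 1
  simp
  ring

lemma ext_of_expIntegral {μ ν : Measure (ℝ × ℝ)} [IsFiniteMeasure μ] [IsFiniteMeasure ν]
    (h : ∀ p, expIntegral μ (imagPair p) = expIntegral ν (imagPair p)) : μ = ν := by
  have hmap : μ.map (WithLp.toLp 2) = ν.map (WithLp.toLp 2) :=
    Measure.ext_of_charFun (funext fun t => by simp_rw [charFun_map_toLp, h])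
  have hinv : ∀ ρ : Measure (ℝ × ℝ), (ρ.map (WithLp.toLp 2)).map WithLp.ofLp = ρ := fun ρ => by
    rw [Measure.map_map (by fun_prop) (by fun_prop)]
    exact Measure.map_id
  rw [← hinv μ, hmap, hinv]

lemma exists_expIntegral_eq_of_tendsto {μ : ℕ → ProbabilityMeasure (ℝ × ℝ)} {f : ℝ × ℝ → ℂ}
    (hf : ContinuousAt f 0)
    (h : ∀ p, Tendsto (fun k => expIntegral (μ k) (imagPair p)) atTop (𝓝 (f p))) :
    ∃ π : ProbabilityMeasure (ℝ × ℝ), ∀ p, expIntegral π (imagPair p) = f p := by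
  obtain ⟨π, hπ⟩ := exists_charFun_eq_of_tendsto
    (μ := fun k => (μ k).map (f := WithLp.toLp 2) (by fun_prop))
    (f := fun t : WithLp 2 (ℝ × ℝ) => f t.ofLp)
    (ContinuousAt.comp (f := WithLp.ofLp) (g := f) hf
      (WithLp.prod_continuous_ofLp 2 ℝ ℝ).continuousAt)
    fun t => by simpa only [ProbabilityMeasure.toMeasure_map, charFun_map_toLp] using h t.ofLp
  refine ⟨π.map (f := WithLp.ofLp) (by fun_prop), fun p => ?_⟩
  have := charFun_map_toLp ((π : Measure (WithLp 2 (ℝ × ℝ))).map WithLp.ofLp) (WithLp.toLp 2 p)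
  rw [Measure.map_map (by fun_prop) (by fun_prop)] at this
  rw [ProbabilityMeasure.toMeasure_map, ← this]
  exact (congrArg (fun ρ => charFun ρ (WithLp.toLp 2 p)) Measure.map_id).trans (congrFun hπ _)

lemma tendsto_of_tendsto_expIntegral {ι : Type*} {l : Filter ι} [l.IsCountablyGenerated]
    {μ : ι → ProbabilityMeasure (ℝ × ℝ)} {π : ProbabilityMeasure (ℝ × ℝ)}
    (h : ∀ p, Tendsto (fun i => expIntegral (μ i) (imagPair p)) l
      (𝓝 (expIntegral π (imagPair p)))) :
    Tendsto μ l (𝓝 π) := by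
  refine tendsto_of_seq_tendsto fun x hx => ?_
  have hlift : Tendsto (fun k => (μ (x k)).map (f := WithLp.toLp 2) (by fun_prop)) atTop
      (𝓝 (π.map (f := WithLp.toLp 2) (by fun_prop))) :=
    ProbabilityMeasure.tendsto_of_tendsto_charFun fun t => by
      simpa only [ProbabilityMeasure.toMeasure_map, charFun_map_toLp, Function.comp_def] using
        (h t.ofLp).comp hx
  have hinv : ∀ ρ : ProbabilityMeasure (ℝ × ℝ),
      (ρ.map (f := WithLp.toLp 2) (by fun_prop)).map (f := WithLp.ofLp) (by fun_prop) = ρ :=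
    fun ρ => by
      refine Subtype.ext ?_
      simp only [ProbabilityMeasure.val_eq_to_measure, ProbabilityMeasure.toMeasure_map]
      rw [Measure.map_map (by fun_prop) (by fun_prop)]
      exact Measure.map_id
  have := ProbabilityMeasure.tendsto_map_of_tendsto_of_continuous _ _ hlift
    (WithLp.prod_continuous_ofLp 2 ℝ ℝ)
  simpa only [hinv, Function.comp_def] using this

namespace AffineSemigroup

variable (S : AffineSemigroup)

/-- The logarithm of the characteristic function of the stationary distribution. -/
def limitExponent (u : ℂ × ℂ) : ℂ := ∫ s in Ioi (0 : ℝ), S.immigration (S.path u s)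

/-- The law at time `max t 0` of the process started at `x`. -/
def law (x : ℝ × ℝ) (hx : 0 ≤ x.1) (t : ℝ) : ProbabilityMeasure (ℝ × ℝ) :=
  ⟨S.P (max t 0) x, S.P_prob _ (le_max_right _ _) x hx⟩

lemma coe_law {x : ℝ × ℝ} (hx : 0 ≤ x.1) {t : ℝ} (ht : 0 ≤ t) :
    (S.law x hx t : Measure (ℝ × ℝ)) = S.P t x := by
  simp [law, max_eq_left ht]

lemma expIntegral_P {t : ℝ} (ht : 0 ≤ t) {x : ℝ × ℝ} (hx : 0 ≤ x.1) (p : ℝ × ℝ) :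
    expIntegral (S.P t x) (imagPair p)
      = Complex.exp (x.1 * (S.path (imagPair p) t).1 + x.2 * (S.path (imagPair p) t).2
          + ∫ s in (0 : ℝ)..t, S.immigration (S.path (imagPair p) s)) :=
  S.P_char t ht x hx _ (by simp [imagPair]) (by simp [imagPair])

lemma expIntegral_bind {μ : Measure (ℝ × ℝ)} [IsProbabilityMeasure μ]
    (hμ : ∀ᵐ x ∂μ, 0 ≤ x.1) {t : ℝ} (ht : 0 ≤ t) (p : ℝ × ℝ) :
    expIntegral (μ.bind (S.P t)) (imagPair p)
      = ∫ x, expIntegral (S.P t x) (imagPair p) ∂μ := by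
  have hprob : ∀ᵐ x ∂μ, IsProbabilityMeasure (S.P t x) := by
    filter_upwards [hμ] with x hx using S.P_prob t ht x hx
  have := isProbabilityMeasure_bind (S.P_meas t ht) hprob
  exact integral_bind (S.P_meas t ht) hprob (integrable_exp_imagPair _ p)

variable {S}

lemma tendsto_expIntegral_P (ha₁ : 0 < S.a₁) (hb₂ : 0 < S.b₂)
    (hlog : ∫⁻ z in {z : ℝ × ℝ | 1 ≤ z.1}, ENNReal.ofReal (Real.log z.1) ∂S.n < ⊤)
    {x : ℝ × ℝ} (hx : 0 ≤ x.1) (p : ℝ × ℝ) :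
    Tendsto (fun t => expIntegral (S.P t x) (imagPair p)) atTop
      (𝓝 (Complex.exp (S.limitExponent (imagPair p)))) := by
  have hpath := tendsto_path ha₁ hb₂ (imagPair_mem p)
  have hintegral : Tendsto (fun t => ∫ s in (0 : ℝ)..t, S.immigration (S.path (imagPair p) s)) atTop
      (𝓝 (S.limitExponent (imagPair p))) :=
    intervalIntegral_tendsto_integral_Ioi 0
      (integrableOn_immigration_path ha₁ hb₂ hlog (imagPair_mem p)) tendsto_id
  have hsum := ((((continuous_fst.tendsto _).comp hpath).const_mul (x.1 : ℂ)).add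
    (((continuous_snd.tendsto _).comp hpath).const_mul (x.2 : ℂ))).add hintegral
  simp only [Prod.fst_zero, Prod.snd_zero, mul_zero, zero_add] at hsum
  refine ((Complex.continuous_exp.tendsto _).comp hsum).congr' ?_
  filter_upwards [eventually_ge_atTop 0] with t ht
  exact (S.expIntegral_P ht hx p).symm

lemma exists_expIntegral_eq_exp_limitExponent (ha₁ : 0 < S.a₁) (hb₂ : 0 < S.b₂)
    (hlog : ∫⁻ z in {z : ℝ × ℝ | 1 ≤ z.1}, ENNReal.ofReal (Real.log z.1) ∂S.n < ⊤) :
    ∃ π : ProbabilityMeasure (ℝ × ℝ),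
      ∀ p, expIntegral π (imagPair p) = Complex.exp (S.limitExponent (imagPair p)) := by
  refine exists_expIntegral_eq_of_tendsto (μ := fun k => S.law 0 le_rfl k) ?_ fun p => ?_
  · have hcont : Continuous imagPair := by
      unfold imagPair
      fun_prop
    have h0 : imagPair 0 = 0 := by simp [imagPair]
    have hexp : ContinuousWithinAt S.limitExponent leftDomain (imagPair 0) := by
      rw [h0]
      exact continuousWithinAt_integral_immigration ha₁ hb₂ hlog
    refine ContinuousAt.cexp ?_
    rw [← continuousWithinAt_univ] at *
    exact hexp.comp hcont.continuousWithinAt fun p _ => imagPair_mem p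
  · refine ((tendsto_expIntegral_P ha₁ hb₂ hlog (le_refl (0 : ℝ × ℝ).1) p).comp
      tendsto_natCast_atTop_atTop).congr fun k => ?_
    rw [S.coe_law le_rfl k.cast_nonneg]
    rfl

lemma tendsto_law (ha₁ : 0 < S.a₁) (hb₂ : 0 < S.b₂)
    (hlog : ∫⁻ z in {z : ℝ × ℝ | 1 ≤ z.1}, ENNReal.ofReal (Real.log z.1) ∂S.n < ⊤)
    {π : ProbabilityMeasure (ℝ × ℝ)}
    (hπ : ∀ p, expIntegral π (imagPair p) = Complex.exp (S.limitExponent (imagPair p)))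
    {x : ℝ × ℝ} (hx : 0 ≤ x.1) : Tendsto (S.law x hx) atTop (𝓝 π) := by
  refine tendsto_of_tendsto_expIntegral fun p => ?_
  rw [hπ]
  refine (tendsto_expIntegral_P ha₁ hb₂ hlog hx p).congr' ?_
  filter_upwards [eventually_ge_atTop 0] with t ht
  rw [S.coe_law hx ht]

lemma measure_fst_neg_eq_zero {π : ProbabilityMeasure (ℝ × ℝ)} {x : ℝ × ℝ} (hx : 0 ≤ x.1)
    (hlim : Tendsto (S.law x hx) atTop (𝓝 π)) :
    (π : Measure (ℝ × ℝ)) {ξ : ℝ × ℝ | ξ.1 < 0} = 0 := by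
  have hle := ProbabilityMeasure.le_liminf_measure_open_of_tendsto hlim
    (isOpen_lt continuous_fst continuous_const : IsOpen {ξ : ℝ × ℝ | ξ.1 < 0})
  have hzero : ∀ t, (S.law x hx t : Measure (ℝ × ℝ)) {ξ : ℝ × ℝ | ξ.1 < 0} = 0 :=
    fun t => S.P_supp _ (le_max_right _ _) x hx
  simpa [hzero] using hle

lemma expIntegral_bind_eq (ha₁ : 0 < S.a₁) (hb₂ : 0 < S.b₂)
    (hlog : ∫⁻ z in {z : ℝ × ℝ | 1 ≤ z.1}, ENNReal.ofReal (Real.log z.1) ∂S.n < ⊤)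
    {π : ProbabilityMeasure (ℝ × ℝ)} {x : ℝ × ℝ} (hx : 0 ≤ x.1)
    (hlim : Tendsto (S.law x hx) atTop (𝓝 π)) {s : ℝ} (hs : 0 ≤ s) (p : ℝ × ℝ) :
    expIntegral ((π : Measure (ℝ × ℝ)).bind (S.P s)) (imagPair p)
      = Complex.exp (S.limitExponent (imagPair p)) := by
  set v := S.path (imagPair p) s with hv
  set c := ∫ r in (0 : ℝ)..s, S.immigration (S.path (imagPair p) r) with hc
  have hmem : v ∈ leftDomain := S.path_mem (imagPair_mem p) hs
  let h : BoundedContinuousFunction (ℝ × ℝ) ℂ :=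
    BoundedContinuousFunction.ofNormedAddCommGroup
      (fun y => Complex.exp (((max y.1 0 : ℝ) : ℂ) * v.1 + (y.2 : ℂ) * v.2 + c)) (by fun_prop)
      (Real.exp c.re) fun y => by
        rw [Complex.norm_exp]
        refine Real.exp_le_exp.2 ?_
        have := mul_nonpos_of_nonneg_of_nonpos (le_max_right y.1 0) hmem.1
        simpa [hmem.2] using this
  have hintegral : ∀ μ : ProbabilityMeasure (ℝ × ℝ), (μ : Measure (ℝ × ℝ)) {ξ | ξ.1 < 0} = 0 →
      ∫ y, h y ∂(μ : Measure (ℝ × ℝ))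
        = expIntegral ((μ : Measure (ℝ × ℝ)).bind (S.P s)) (imagPair p) := by
    intro μ hμ
    have hae : ∀ᵐ y ∂(μ : Measure (ℝ × ℝ)), 0 ≤ y.1 := by
      simpa [ae_iff] using hμ
    rw [S.expIntegral_bind hae hs]
    refine integral_congr_ae ?_
    filter_upwards [hae] with y hy
    rw [S.expIntegral_P hs hy]
    simp only [h, BoundedContinuousFunction.coe_ofNormedAddCommGroup, max_eq_left hy, hv, hc]
  have hweak := (ProbabilityMeasure.tendsto_iff_forall_integral_rclike_tendsto ℂ).1 hlim h
  rw [hintegral π (measure_fst_neg_eq_zero hx hlim)] at hweak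
  refine tendsto_nhds_unique hweak ?_
  have hshift := (tendsto_expIntegral_P ha₁ hb₂ hlog hx p).comp
    (tendsto_atTop_add_const_right atTop s tendsto_id)
  refine hshift.congr' ?_
  filter_upwards [eventually_ge_atTop 0] with t ht
  rw [hintegral (S.law x hx t) (S.P_supp _ (le_max_right _ _) x hx), S.coe_law hx ht,
    ← S.P_CK t ht s hs x]
  rfl

lemma expIntegral_eq_of_isStationary (ha₁ : 0 < S.a₁) (hb₂ : 0 < S.b₂)
    (hlog : ∫⁻ z in {z : ℝ × ℝ | 1 ≤ z.1}, ENNReal.ofReal (Real.log z.1) ∂S.n < ⊤)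
    {π : Measure (ℝ × ℝ)} (hπ : IsStationary S.P π) (p : ℝ × ℝ) :
    expIntegral π (imagPair p) = Complex.exp (S.limitExponent (imagPair p)) := by
  obtain ⟨hprob, hsupp, hinv⟩ := hπ
  have hae : ∀ᵐ x ∂π, 0 ≤ x.1 := by simpa [ae_iff] using hsupp
  have hmeas : ∀ k : ℕ, AEStronglyMeasurable
      (fun x => expIntegral (S.P k x) (imagPair p)) π := by
    intro k
    have hcont : ContinuousOn (fun x : ℝ × ℝ => Complex.exp
        (x.1 * (S.path (imagPair p) k).1 + x.2 * (S.path (imagPair p) k).2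
          + ∫ s in (0 : ℝ)..k, S.immigration (S.path (imagPair p) s))) univ := by fun_prop
    refine (continuousOn_univ.1 hcont).aestronglyMeasurable.congr ?_
    filter_upwards [hae] with x hx
    exact (S.expIntegral_P k.cast_nonneg hx p).symm
  have hlim : Tendsto (fun k : ℕ => ∫ x, expIntegral (S.P k x) (imagPair p) ∂π) atTop
      (𝓝 (∫ _, Complex.exp (S.limitExponent (imagPair p)) ∂π)) := by
    refine tendsto_integral_of_dominated_convergence (fun _ => 1) hmeas (integrable_const 1) ?_ ?_
    · intro k
      filter_upwards [hae] with x hx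
      have := S.P_prob k k.cast_nonneg x hx
      exact norm_expIntegral_le_one _ p
    · filter_upwards [hae] with x hx
      exact (tendsto_expIntegral_P ha₁ hb₂ hlog hx p).comp tendsto_natCast_atTop_atTop
  have hconst : ∀ k : ℕ, ∫ x, expIntegral (S.P k x) (imagPair p) ∂π
      = expIntegral π (imagPair p) := fun k => by
    rw [← S.expIntegral_bind hae k.cast_nonneg, hinv k k.cast_nonneg]
  simp_rw [hconst] at hlim
  simpa using tendsto_nhds_unique tendsto_const_nhds hlim

end AffineSemigroup

/-- Lemma 3.4: existence, characteristic function, and uniqueness of the stationary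
distribution. -/
theorem stationary_distribution_exists
    (S : AffineSemigroup)
    (ha₁ : 0 < S.a₁) (hb₂ : 0 < S.b₂)
    (hlog : ∫⁻ z in {z : ℝ × ℝ | 1 ≤ z.1}, ENNReal.ofReal (Real.log z.1) ∂S.n < ⊤) :
    ∃ π : Measure (ℝ × ℝ), IsProbabilityMeasure π ∧ π {x : ℝ × ℝ | x.1 < 0} = 0 ∧
      (∀ x : ℝ × ℝ, 0 ≤ x.1 → ∀ f : BoundedContinuousFunction (ℝ × ℝ) ℝ,
        Tendsto (fun t => ∫ ξ, f ξ ∂(S.P t x)) atTop (𝓝 (∫ ξ, f ξ ∂π))) ∧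
      (∀ u : ℂ × ℂ, u.1.re = 0 → u.2.re = 0 →
        ∫ y : ℝ × ℝ, Complex.exp (u.1 * (y.1 : ℂ) + u.2 * (y.2 : ℂ)) ∂π
          = Complex.exp (∫ s in Set.Ioi (0:ℝ),
              psi S.a₂ S.b₀ S.σ S.n
                (S.V₁ s u, Complex.exp (-(S.b₂ : ℂ) * (s : ℂ)) * u.2))) ∧
      IsStationary S.P π ∧
      ∀ π' : Measure (ℝ × ℝ), IsStationary S.P π' → π' = π := by
  obtain ⟨π, hπ⟩ := AffineSemigroup.exists_expIntegral_eq_exp_limitExponent ha₁ hb₂ hlog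
  have hlim : ∀ (x : ℝ × ℝ) (hx : 0 ≤ x.1), Tendsto (S.law x hx) atTop (𝓝 π) :=
    fun x hx => AffineSemigroup.tendsto_law ha₁ hb₂ hlog hπ hx
  have hlim0 := hlim 0 le_rfl
  have hsupp := AffineSemigroup.measure_fst_neg_eq_zero le_rfl hlim0
  have hae : ∀ᵐ x ∂(π : Measure (ℝ × ℝ)), 0 ≤ x.1 := by simpa [ae_iff] using hsupp
  refine ⟨π, inferInstance, hsupp, fun x hx f => ?_, fun u h1 h2 => ?_,
    ⟨inferInstance, hsupp, fun t ht => ?_⟩, fun π' hπ' => ?_⟩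
  · refine (ProbabilityMeasure.tendsto_iff_forall_integral_tendsto.1 (hlim x hx) f).congr' ?_
    filter_upwards [eventually_ge_atTop 0] with t ht
    rw [S.coe_law hx ht]
  · obtain ⟨p, rfl⟩ := exists_eq_imagPair h1 h2
    exact hπ p
  · have := isProbabilityMeasure_bind (μ := (π : Measure (ℝ × ℝ))) (S.P_meas t ht)
      (by filter_upwards [hae] with x hx using S.P_prob t ht x hx)
    refine ext_of_expIntegral fun p => ?_
    rw [AffineSemigroup.expIntegral_bind_eq ha₁ hb₂ hlog le_rfl hlim0 ht, hπ]
  · have := hπ'.1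
    refine ext_of_expIntegral fun p => ?_
    rw [AffineSemigroup.expIntegral_eq_of_isStationary ha₁ hb₂ hlog hπ', hπ]

end AffinePaper
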